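/- Let (aᵢ, bᵢ, cᵢ, dᵢ), i = 1, 2, 3, 4, be quadruples of positive reals with aᵢ + bᵢ = cᵢ + dᵢ for each i, and let gᵢ(x) = g(x; aᵢ, bᵢ, cᵢ, dᵢ). Suppose I ⊆ (−1, 1) is a nonempty open interval such that for every x ∈ I the successive values x₄ = x, x₃ = g₄(x₄), x₂ = g₃(x₃), x₁ = g₂(x₂) each lie in the valid domain of the corresponding function (all arccos arguments in (−1, 1) and all four interior angles of the corresponding quadrilateral in (0, π)). Then g₁(g₂(g₃(g₄(x)))) = x for all x ∈ I if and only if aᵢ = cᵢ and bᵢ = dᵢ for every i = 1, 2, 3, 4 (i.e., all four quadrilaterals are parallelograms). -/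

import Mathlib

open Real Set

/-- `E(x) = √(a² + d² + 2adx)`, the diagonal of the quadrilateral with consecutive side
lengths `a, b, c, d` and cosine `−x` of the interior angle between the sides `d` and `a`. -/
noncomputable def diagE (a d x : ℝ) : ℝ := Real.sqrt (a ^ 2 + d ^ 2 + 2 * a * d * x)

/-- `g(x; a, b, c, d) = cos(arccos((a² + E² − d²)/(2aE)) + arccos((b² + E² − c²)/(2bE)))`. -/
noncomputable def gfun (a b c d x : ℝ) : ℝ :=
  Real.cos (Real.arccos ((a ^ 2 + (diagE a d x) ^ 2 - d ^ 2) / (2 * a * diagE a d x))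
    + Real.arccos ((b ^ 2 + (diagE a d x) ^ 2 - c ^ 2) / (2 * b * diagE a d x)))

/-- `x` lies in the valid domain of `g(·; a, b, c, d)`: `x ∈ (−1, 1)`, all arccos arguments
are in `(−1, 1)`, and all four interior angles `α = arccos(−x)`, `β`, `γ`,
`δ = 2π − α − β − γ` of the corresponding quadrilateral lie in `(0, π)`. -/
noncomputable def validDomain (a b c d x : ℝ) : Prop :=
  x ∈ Ioo (-1 : ℝ) 1 ∧
  (a ^ 2 + (diagE a d x) ^ 2 - d ^ 2) / (2 * a * diagE a d x) ∈ Ioo (-1 : ℝ) 1 ∧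
  (b ^ 2 + (diagE a d x) ^ 2 - c ^ 2) / (2 * b * diagE a d x) ∈ Ioo (-1 : ℝ) 1 ∧
  Real.arccos (-x) ∈ Ioo 0 π ∧
  (Real.arccos ((a ^ 2 + (diagE a d x) ^ 2 - d ^ 2) / (2 * a * diagE a d x))
    + Real.arccos ((b ^ 2 + (diagE a d x) ^ 2 - c ^ 2) / (2 * b * diagE a d x))) ∈ Ioo 0 π ∧
  Real.arccos ((b ^ 2 + c ^ 2 - (diagE a d x) ^ 2) / (2 * b * c)) ∈ Ioo 0 π ∧
  (2 * π - Real.arccos (-x)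
    - (Real.arccos ((a ^ 2 + (diagE a d x) ^ 2 - d ^ 2) / (2 * a * diagE a d x))
       + Real.arccos ((b ^ 2 + (diagE a d x) ^ 2 - c ^ 2) / (2 * b * diagE a d x)))
    - Real.arccos ((b ^ 2 + c ^ 2 - (diagE a d x) ^ 2) / (2 * b * c))) ∈ Ioo 0 π

/-- The radicand occurring in `cotMap`. -/
def cotRad (p : ℝ × ℝ) (X : ℝ) : ℝ := p.2 * X ^ 2 + p.2 - 1

/-- The map `g` in the coordinate `X = cot (α / 2)`, with parameters
`p = (b / (a + b), b * c / (a * d))`. -/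
noncomputable def cotMap (p : ℝ × ℝ) (X : ℝ) : ℝ :=
  p.1 * X + (1 - p.1) * √(cotRad p X)

/-- Composition of the maps `cotMap p`, the head of the list being applied first. -/
noncomputable def cotComp : List (ℝ × ℝ) → ℝ → ℝ
  | [], X => X
  | p :: L, X => cotComp L (cotMap p X)

/-- All radicands met when evaluating `cotComp L X` are positive. -/
def CotRegular : List (ℝ × ℝ) → ℝ → Prop
  | [], _ => True
  | p :: L, X => 0 < cotRad p X ∧ CotRegular L (cotMap p X)

/-- The parameter range of `cotMap`. -/
def CotAdmissible (p : ℝ × ℝ) : Prop := 0 < p.1 ∧ p.1 < 1 ∧ 0 < p.2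

lemma continuous_cotRad (p : ℝ × ℝ) : Continuous (cotRad p) := by
  unfold cotRad; fun_prop

lemma continuous_cotMap (p : ℝ × ℝ) : Continuous (cotMap p) := by
  have := continuous_cotRad p
  unfold cotMap; fun_prop

lemma continuous_cotComp (L : List (ℝ × ℝ)) : Continuous (cotComp L) := by
  induction L with
  | nil => exact continuous_id
  | cons p L ih => exact ih.comp (continuous_cotMap p)

lemma isOpen_cotRegular (L : List (ℝ × ℝ)) : IsOpen {X | CotRegular L X} := by
  induction L with
  | nil => simp [CotRegular]
  | cons p L ih =>
    exact (isOpen_lt continuous_const (continuous_cotRad p)).inter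
      (ih.preimage (continuous_cotMap p))

lemma cotRad_mono {p : ℝ × ℝ} (hp : CotAdmissible p) {X Y : ℝ} (hX : 0 ≤ X) (hXY : X ≤ Y) :
    cotRad p X ≤ cotRad p Y := by
  have := hp.2.2
  unfold cotRad; gcongr

lemma cotMap_sub_ge {p : ℝ × ℝ} (hp : CotAdmissible p) {X Y : ℝ} (hX : 0 ≤ X) (hXY : X ≤ Y) :
    p.1 * (Y - X) ≤ cotMap p Y - cotMap p X := by
  have h := Real.sqrt_le_sqrt (cotRad_mono hp hX hXY)
  have h1 := hp.2.1
  unfold cotMap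
  nlinarith

lemma mul_le_cotMap {p : ℝ × ℝ} (hp : CotAdmissible p) (X : ℝ) : p.1 * X ≤ cotMap p X := by
  have h := Real.sqrt_nonneg (cotRad p X)
  have h1 := hp.2.1
  unfold cotMap
  nlinarith

lemma cotMap_nonneg {p : ℝ × ℝ} (hp : CotAdmissible p) {X : ℝ} (hX : 0 ≤ X) :
    0 ≤ cotMap p X :=
  (mul_nonneg hp.1.le hX).trans (mul_le_cotMap hp X)

lemma cotMap_pos {p : ℝ × ℝ} (hp : CotAdmissible p) {X : ℝ} (hX : 0 < X) :
    0 < cotMap p X :=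
  (mul_pos hp.1 hX).trans_le (mul_le_cotMap hp X)

lemma cotMap_mono {p : ℝ × ℝ} (hp : CotAdmissible p) {X Y : ℝ} (hX : 0 ≤ X) (hXY : X ≤ Y) :
    cotMap p X ≤ cotMap p Y := by
  have := cotMap_sub_ge hp hX hXY
  have := mul_nonneg hp.1.le (sub_nonneg.2 hXY)
  linarith

lemma cotMap_eq_self {p : ℝ × ℝ} (hp : p.2 = 1) {X : ℝ} (hX : 0 ≤ X) : cotMap p X = X := by
  have : cotRad p X = X ^ 2 := by rw [cotRad, hp]; ring
  rw [cotMap, this, Real.sqrt_sq hX]; ring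

lemma cotComp_nonneg {L : List (ℝ × ℝ)} (hL : ∀ p ∈ L, CotAdmissible p) {X : ℝ} (hX : 0 ≤ X) :
    0 ≤ cotComp L X := by
  induction L generalizing X with
  | nil => exact hX
  | cons p L ih =>
    exact ih (fun q hq => hL q (by simp [hq])) (cotMap_nonneg (hL p (by simp)) hX)

lemma cotComp_expanding (L : List (ℝ × ℝ)) (hL : ∀ p ∈ L, CotAdmissible p) :
    ∃ k > 0, ∀ X Y : ℝ, 0 ≤ X → X ≤ Y → k * (Y - X) ≤ cotComp L Y - cotComp L X := by
  induction L with
  | nil => exact ⟨1, one_pos, fun X Y _ _ => by simp [cotComp]⟩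
  | cons p L ih =>
    obtain ⟨k, hk, h⟩ := ih fun q hq => hL q (by simp [hq])
    have hp := hL p (by simp)
    refine ⟨k * p.1, mul_pos hk hp.1, fun X Y hX hXY => ?_⟩
    have h1 := h _ _ (cotMap_nonneg hp hX) (cotMap_mono hp hX hXY)
    have h2 := mul_le_mul_of_nonneg_left (cotMap_sub_ge hp hX hXY) hk.le
    simp only [cotComp]
    linarith

lemma CotRegular.mono {L : List (ℝ × ℝ)} (hL : ∀ p ∈ L, CotAdmissible p) {X Y : ℝ}
    (h : CotRegular L X) (hX : 0 ≤ X) (hXY : X ≤ Y) : CotRegular L Y := by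
  induction L generalizing X Y with
  | nil => trivial
  | cons p L ih =>
    have hp := hL p (by simp)
    exact ⟨h.1.trans_le (cotRad_mono hp hX hXY),
      ih (fun q hq => hL q (by simp [hq])) h.2 (cotMap_nonneg hp hX) (cotMap_mono hp hX hXY)⟩

lemma CotRegular.analyticAt {L : List (ℝ × ℝ)} {X : ℝ} (h : CotRegular L X) :
    AnalyticAt ℝ (cotComp L) X := by
  induction L generalizing X with
  | nil => exact analyticAt_id
  | cons p L ih =>
    have h1 : AnalyticAt ℝ (cotRad p) X := by unfold cotRad; fun_prop
    have h2 : AnalyticAt ℝ (fun Y => √(cotRad p Y)) X :=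
      (Real.contDiffAt_sqrt h.1.ne').analyticAt.comp h1
    have h3 : AnalyticAt ℝ (cotMap p) X := by unfold cotMap; fun_prop
    exact (ih h.2).comp h3

/-- At a point on the boundary of the regular set the composition grows like a square root. -/
lemma cotComp_sqrt_growth (L : List (ℝ × ℝ)) (hL : ∀ p ∈ L, CotAdmissible p) {X : ℝ}
    (hX : 0 < X) (hreg : ∀ Y > X, CotRegular L Y) (hsing : ¬ CotRegular L X) :
    ∃ k > 0, ∀ Y > X, k * √(Y - X) ≤ cotComp L Y - cotComp L X := by
  induction L generalizing X with
  | nil => exact absurd trivial hsing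
  | cons p L ih =>
    have hp := hL p (by simp)
    have hL' : ∀ q ∈ L, CotAdmissible q := fun q hq => hL q (by simp [hq])
    by_cases hrad : 0 < cotRad p X
    · have hsing' : ¬ CotRegular L (cotMap p X) := fun h => hsing ⟨hrad, h⟩
      have hreg' : ∀ Z > cotMap p X, CotRegular L Z := by
        intro Z hZ
        have h1 : ∀ᶠ Y in nhdsWithin X (Ioi X), cotMap p Y < Z :=
          nhdsWithin_le_nhds ((continuous_cotMap p).continuousAt.eventually (gt_mem_nhds hZ))
        obtain ⟨Y, hY, hXY⟩ := (h1.and self_mem_nhdsWithin).exists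
        exact (hreg Y hXY).2.mono hL' (cotMap_nonneg hp (hX.trans hXY).le) hY.le
      obtain ⟨k, hk, h⟩ := ih hL' (cotMap_pos hp hX) hreg' hsing'
      refine ⟨k * √p.1, mul_pos hk (Real.sqrt_pos.2 hp.1), fun Y hY => ?_⟩
      have h2 := cotMap_sub_ge hp hX.le hY.le
      have h3 : cotMap p X < cotMap p Y := by
        have := mul_pos hp.1 (sub_pos.2 hY)
        linarith
      refine le_trans ?_ (h _ h3)
      rw [mul_assoc, ← Real.sqrt_mul hp.1.le]
      gcongr
    · have h0 : cotRad p X = 0 := by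
        refine le_antisymm (not_lt.1 hrad) (ge_of_tendsto
          ((continuous_cotRad p).continuousAt.mono_left (nhdsWithin_le_nhds (s := Ioi X))) ?_)
        filter_upwards [self_mem_nhdsWithin] with Y hY using (hreg Y hY).1.le
      obtain ⟨k, hk, h⟩ := cotComp_expanding L hL'
      have hr := hp.2.2
      have h1 : 0 < 1 - p.1 := sub_pos.2 hp.2.1
      refine ⟨k * ((1 - p.1) * √(2 * p.2 * X)), by positivity, fun Y hY => ?_⟩
      refine le_trans ?_ (h _ _ (cotMap_nonneg hp hX.le) (cotMap_mono hp hX.le hY.le))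
      have h2 : √(2 * p.2 * X) * √(Y - X) ≤ √(cotRad p Y) := by
        rw [← Real.sqrt_mul (by positivity)]
        apply Real.sqrt_le_sqrt
        have : cotRad p Y = cotRad p X + p.2 * (Y + X) * (Y - X) := by unfold cotRad; ring
        rw [this, h0]
        nlinarith [mul_nonneg hr.le (sq_nonneg (Y - X))]
      have h3 : (1 - p.1) * (√(2 * p.2 * X) * √(Y - X)) ≤ cotMap p Y - cotMap p X := by
        have h4 : cotMap p Y - cotMap p X = p.1 * (Y - X) + (1 - p.1) * √(cotRad p Y) := by
          rw [cotMap, cotMap, h0, Real.sqrt_zero]; ring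
        have h5 := mul_le_mul_of_nonneg_left h2 h1.le
        have h6 := mul_nonneg hp.1.le (sub_pos.2 hY).le
        linarith
      calc _ = k * ((1 - p.1) * (√(2 * p.2 * X) * √(Y - X))) := by ring
        _ ≤ _ := by gcongr

/-- A composition that is the identity near one regular point is regular, and the identity, on the
whole positive half-line. -/
lemma cotRegular_and_cotComp_eq (L : List (ℝ × ℝ)) (hL : ∀ p ∈ L, CotAdmissible p) {X₀ : ℝ}
    (hX₀ : 0 < X₀) (hreg : CotRegular L X₀) (hid : ∀ᶠ X in nhds X₀, cotComp L X = X) :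
    ∀ X > 0, CotRegular L X ∧ cotComp L X = X := by
  set J : Set ℝ := {X | 0 < X ∧ CotRegular L X}
  have hJid : EqOn (cotComp L) id J := by
    have hconn : IsPreconnected J := by
      apply Set.OrdConnected.isPreconnected
      exact ⟨fun X hX Y _ Z hZ => ⟨hX.1.trans_le hZ.1, hX.2.mono hL hX.1.le hZ.1⟩⟩
    have han : AnalyticOnNhd ℝ (cotComp L) J := fun X hX => hX.2.analyticAt
    exact han.eqOn_of_preconnected_of_eventuallyEq (fun _ _ => analyticAt_id) hconn
      ⟨hX₀, hreg⟩ hid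
  suffices hall : ∀ X > 0, CotRegular L X from
    fun X hX => ⟨hall X hX, hJid ⟨hX, hall X hX⟩⟩
  by_contra! hcon
  obtain ⟨W, hW, hWs⟩ := hcon
  have hbdd : ∀ X ∈ J, W ≤ X := fun X hX => by
    by_contra! hlt
    exact hWs (hX.2.mono hL hX.1.le hlt.le)
  have hne : J.Nonempty := ⟨X₀, hX₀, hreg⟩
  set m := sInf J
  have hm : 0 < m := hW.trans_le (le_csInf hne hbdd)
  have hlow : ∀ X ∈ J, m ≤ X := fun X hX => csInf_le ⟨W, hbdd⟩ hX
  have hright : ∀ Y > m, CotRegular L Y := fun Y hY => by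
    obtain ⟨X, hX, hXY⟩ := exists_lt_of_csInf_lt hne hY
    exact hX.2.mono hL hX.1.le hXY.le
  have hsing : ¬ CotRegular L m := fun h => by
    have h1 : ∀ᶠ X in nhdsWithin m (Iio m), X ∈ J :=
      nhdsWithin_le_nhds ((lt_mem_nhds hm).and ((isOpen_cotRegular L).mem_nhds h))
    obtain ⟨X, hX, hXm⟩ := (h1.and self_mem_nhdsWithin).exists
    exact absurd (hlow X hX) (not_le.2 hXm)
  have hFm : cotComp L m = m := by
    have h1 : Filter.Tendsto (cotComp L) (nhdsWithin m (Ioi m)) (nhds (cotComp L m)) :=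
      (continuous_cotComp L).continuousAt.mono_left nhdsWithin_le_nhds
    have h2 : Filter.Tendsto (cotComp L) (nhdsWithin m (Ioi m)) (nhds m) := by
      refine Filter.Tendsto.congr' ?_ (Filter.tendsto_id.mono_left nhdsWithin_le_nhds)
      filter_upwards [self_mem_nhdsWithin] with Y hY
      exact (hJid ⟨hm.trans hY, hright Y hY⟩).symm
    exact tendsto_nhds_unique h1 h2
  obtain ⟨k, hk, h⟩ := cotComp_sqrt_growth L hL hm hright hsing
  have hY : m < m + (k / 2) ^ 2 := by simp; positivity
  have h1 := h _ hY
  rw [hJid ⟨hm.trans hY, hright _ hY⟩, hFm, id, add_sub_cancel_left,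
    Real.sqrt_sq (by positivity)] at h1
  nlinarith

lemma eq_one_of_cotComp_eq_id (L : List (ℝ × ℝ)) (hL : ∀ p ∈ L, CotAdmissible p)
    (h : ∀ X > 0, CotRegular L X ∧ cotComp L X = X) : ∀ p ∈ L, p.2 = 1 := by
  induction L with
  | nil => simp
  | cons p L ih =>
    have hp := hL p (by simp)
    have hL' : ∀ q ∈ L, CotAdmissible q := fun q hq => hL q (by simp [hq])
    have hp1 : p.2 = 1 := by
      have hge : 0 ≤ cotRad p 0 := by
        refine ge_of_tendsto
          ((continuous_cotRad p).continuousAt.mono_left (nhdsWithin_le_nhds (s := Ioi 0))) ?_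
        filter_upwards [self_mem_nhdsWithin] with Y hY using (h Y hY).1.1.le
      have hF0 : cotComp (p :: L) 0 ≤ 0 := by
        refine le_of_tendsto_of_tendsto
          ((continuous_cotComp (p :: L)).continuousAt.mono_left
            (nhdsWithin_le_nhds (s := Ioi 0)))
          ((continuous_id (X := ℝ)).continuousAt.mono_left nhdsWithin_le_nhds) ?_
        filter_upwards [self_mem_nhdsWithin] with Y hY using (h Y hY).2.le
      refine le_antisymm ?_ (by simpa [cotRad] using hge)
      by_contra! hlt
      have hrad : 0 < cotRad p 0 := by simpa [cotRad] using hlt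
      have hpos : 0 < cotMap p 0 := by
        have := mul_pos (sub_pos.2 hp.2.1) (Real.sqrt_pos.2 hrad)
        simpa [cotMap] using this
      obtain ⟨k, hk, hexp⟩ := cotComp_expanding L hL'
      have h1 := hexp 0 _ le_rfl hpos.le
      have h2 := cotComp_nonneg hL' (le_refl (0 : ℝ))
      have h3 : 0 < k * (cotMap p 0 - 0) := by simpa using mul_pos hk hpos
      simp only [cotComp] at hF0
      linarith
    have hrec : ∀ X > 0, CotRegular L X ∧ cotComp L X = X := fun X hX => by
      have := h X hX
      rw [cotComp, CotRegular, cotMap_eq_self hp1 (le_of_lt hX)] at this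
      exact ⟨this.1.2, this.2⟩
    intro q hq
    rcases List.mem_cons.1 hq with rfl | hq
    · exact hp1
    · exact ih hL' hrec q hq

/-- The coordinate `cot (α / 2)` in terms of `x = -cos α`. -/
noncomputable def cotCoord (x : ℝ) : ℝ := √((1 - x) / (1 + x))

/-- The parameters of `cotMap` belonging to the side lengths `a, b, c, d`. -/
noncomputable def cotParam (a b c d : ℝ) : ℝ × ℝ := (b / (a + b), b * c / (a * d))

lemma cotCoord_pos {x : ℝ} (hx : x ∈ Ioo (-1 : ℝ) 1) : 0 < cotCoord x :=
  Real.sqrt_pos.2 (div_pos (by linarith [hx.2]) (by linarith [hx.1]))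

lemma cotCoord_sq {x : ℝ} (hx : x ∈ Ioo (-1 : ℝ) 1) : cotCoord x ^ 2 = (1 - x) / (1 + x) :=
  Real.sq_sqrt (div_pos (by linarith [hx.2]) (by linarith [hx.1])).le

lemma cotCoord_inverse {X : ℝ} (hX : 0 ≤ X) : cotCoord ((1 - X ^ 2) / (1 + X ^ 2)) = X := by
  have h : (1 - (1 - X ^ 2) / (1 + X ^ 2)) / (1 + (1 - X ^ 2) / (1 + X ^ 2)) = X ^ 2 := by
    have : 1 + X ^ 2 ≠ 0 := by positivity
    field_simp
    ring
  rw [cotCoord, h, Real.sqrt_sq hX]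

lemma inverse_cotCoord {x : ℝ} (hx : x ∈ Ioo (-1 : ℝ) 1) :
    (1 - cotCoord x ^ 2) / (1 + cotCoord x ^ 2) = x := by
  have : 1 + x ≠ 0 := by linarith [hx.1]
  rw [cotCoord_sq hx]
  field_simp
  ring

lemma cotAdmissible_cotParam {a b c d : ℝ} (ha : 0 < a) (hb : 0 < b) (hc : 0 < c) (hd : 0 < d) :
    CotAdmissible (cotParam a b c d) := by
  refine ⟨by simp only [cotParam]; positivity, ?_, by simp only [cotParam]; positivity⟩
  simp only [cotParam]
  rw [div_lt_one (by positivity)]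
  linarith

lemma cotParam_snd_eq_one {a b c d : ℝ} (ha : 0 < a) (hb : 0 < b) (hd : 0 < d)
    (hs : a + b = c + d) (h : (cotParam a b c d).2 = 1) : a = c ∧ b = d := by
  have h1 : b * c = a * d := by
    simp only [cotParam] at h
    rwa [div_eq_one_iff_eq (by positivity)] at h
  have h2 : (a + b) * (b - d) = 0 := by
    linear_combination b * hs + h1
  have h3 : b = d := by
    rcases mul_eq_zero.1 h2 with h | h <;> linarith
  exact ⟨by linarith, h3⟩

lemma two_mul_bc_sub_pos {a b c d x : ℝ} (ha : 0 < a) (hb : 0 < b) (hd : 0 < d)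
    (hs : a + b = c + d) (h : validDomain a b c d x) :
    0 < 2 * (b * c) - a * d * (1 + x) := by
  obtain ⟨hx, -, hB, -⟩ := h
  have hu : 0 < 1 + x := by linarith [hx.1]
  have hEsq : 0 < a ^ 2 + d ^ 2 + 2 * a * d * x := by
    nlinarith [sq_nonneg (a - d), mul_pos (mul_pos ha hd) hu]
  have hE : 0 < diagE a d x := Real.sqrt_pos.2 hEsq
  have hE2 : diagE a d x ^ 2 = a ^ 2 + d ^ 2 + 2 * a * d * x := Real.sq_sqrt hEsq.le
  set E := diagE a d x
  have h1 : 0 < (1 - ((b ^ 2 + E ^ 2 - c ^ 2) / (2 * b * E)) ^ 2) * (b * E) ^ 2 :=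
    mul_pos (by nlinarith [hB.1, hB.2]) (by positivity)
  have h2 : (1 - ((b ^ 2 + E ^ 2 - c ^ 2) / (2 * b * E)) ^ 2) * (b * E) ^ 2
      = a * d * (1 + x) * (2 * (b * c) - a * d * (1 + x)) := by
    have h3 : (1 - ((b ^ 2 + E ^ 2 - c ^ 2) / (2 * b * E)) ^ 2) * (b * E) ^ 2
      = b ^ 2 * E ^ 2 - (b ^ 2 + E ^ 2 - c ^ 2) ^ 2 / 4 := by
      field_simp
      ring
    rw [h3, hE2]
    obtain rfl : c = a + b - d := by linarith
    ring
  rw [h2] at h1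
  exact pos_of_mul_pos_right h1 (by positivity)

lemma one_add_gfun_mul {a b c d x : ℝ} (ha : 0 < a) (hb : 0 < b) (hc : 0 < c) (hd : 0 < d)
    (hs : a + b = c + d) (h : validDomain a b c d x) :
    (1 + gfun a b c d x) * (b * (a * c + b * d + a * d * (1 + x)
      + √(a * d * (1 - x) * (2 * (b * c) - a * d * (1 + x))))) = d * (1 + x) * (a + b) ^ 2 := by
  have hpos := two_mul_bc_sub_pos ha hb hd hs h
  obtain ⟨hx, hA, hB, -⟩ := h
  have hu : 0 < 1 + x := by linarith [hx.1]
  have hv : 0 < 1 - x := by linarith [hx.2]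
  have hEsq : 0 < a ^ 2 + d ^ 2 + 2 * a * d * x := by
    nlinarith [sq_nonneg (a - d), mul_pos (mul_pos ha hd) hu]
  have hE : 0 < diagE a d x := Real.sqrt_pos.2 hEsq
  have hE2 : diagE a d x ^ 2 = a ^ 2 + d ^ 2 + 2 * a * d * x := Real.sq_sqrt hEsq.le
  rw [gfun, Real.cos_add, Real.cos_arccos hA.1.le hA.2.le, Real.cos_arccos hB.1.le hB.2.le,
    Real.sin_arccos, Real.sin_arccos]
  set E := diagE a d x
  set S := √(a * d * (1 - x) * (2 * (b * c) - a * d * (1 + x)))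
  have hS2 : S ^ 2 = a * d * (1 - x) * (2 * (b * c) - a * d * (1 + x)) :=
    Real.sq_sqrt (by positivity)
  have hS : 0 ≤ S := Real.sqrt_nonneg _
  have hc' : c = a + b - d := by linarith
  have hA1 : 0 ≤ 1 - ((a ^ 2 + E ^ 2 - d ^ 2) / (2 * a * E)) ^ 2 := by
    nlinarith [hA.1, hA.2]
  have hsin : √(1 - ((a ^ 2 + E ^ 2 - d ^ 2) / (2 * a * E)) ^ 2) *
      √(1 - ((b ^ 2 + E ^ 2 - c ^ 2) / (2 * b * E)) ^ 2) = d * (1 + x) * S / (b * E ^ 2) := by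
    have hrhs : 0 ≤ d * (1 + x) * S / (b * E ^ 2) := by positivity
    rw [← Real.sqrt_mul hA1, ← Real.sqrt_sq hrhs]
    congr 1
    have hsinA : 1 - ((a ^ 2 + E ^ 2 - d ^ 2) / (2 * a * E)) ^ 2
        = d ^ 2 * (1 + x) * (1 - x) / E ^ 2 := by
      have h1 : 1 - ((a ^ 2 + E ^ 2 - d ^ 2) / (2 * a * E)) ^ 2
          = (4 * a ^ 2 * E ^ 2 - (a ^ 2 + E ^ 2 - d ^ 2) ^ 2) / (4 * a ^ 2 * E ^ 2) := by
        field_simp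
        ring
      rw [h1, hE2]
      field_simp
      ring
    have hsinB : 1 - ((b ^ 2 + E ^ 2 - c ^ 2) / (2 * b * E)) ^ 2
        = a * d * (1 + x) * (2 * (b * c) - a * d * (1 + x)) / (b ^ 2 * E ^ 2) := by
      have h1 : 1 - ((b ^ 2 + E ^ 2 - c ^ 2) / (2 * b * E)) ^ 2
          = (4 * b ^ 2 * E ^ 2 - (b ^ 2 + E ^ 2 - c ^ 2) ^ 2) / (4 * b ^ 2 * E ^ 2) := by
        field_simp
        ring
      rw [h1, hE2, hc']
      field_simp
      ring
    have hsq : (d * (1 + x) * S / (b * E ^ 2)) ^ 2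
        = d ^ 2 * (1 + x) ^ 2 * S ^ 2 / (b ^ 2 * E ^ 4) := by
      field_simp
    rw [hsinA, hsinB, hsq, hS2]
    field_simp
  have hcos : (a ^ 2 + E ^ 2 - d ^ 2) / (2 * a * E) * ((b ^ 2 + E ^ 2 - c ^ 2) / (2 * b * E))
      = (a ^ 2 + E ^ 2 - d ^ 2) * (b ^ 2 + E ^ 2 - c ^ 2) / (4 * a * b * E ^ 2) := by
    field_simp
    ring
  rw [hsin, hcos]
  have key : 1 + ((a ^ 2 + E ^ 2 - d ^ 2) * (b ^ 2 + E ^ 2 - c ^ 2) / (4 * a * b * E ^ 2)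
      - d * (1 + x) * S / (b * E ^ 2))
      = d * (1 + x) * (a * c + b * d + a * d * (1 + x) - S) / (b * E ^ 2) := by
    field_simp
    rw [hE2, hc']
    ring
  have key2 : (a * c + b * d + a * d * (1 + x) - S) * (a * c + b * d + a * d * (1 + x) + S)
      = (a + b) ^ 2 * E ^ 2 := by
    rw [hE2]
    have : (a * c + b * d + a * d * (1 + x) - S) * (a * c + b * d + a * d * (1 + x) + S)
      = (a * c + b * d + a * d * (1 + x)) ^ 2 - S ^ 2 := by ring
    rw [this, hS2, hc']
    ring
  rw [key]
  field_simp
  linear_combination key2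

lemma cotRad_cotParam_pos {a b c d x : ℝ} (ha : 0 < a) (hb : 0 < b) (hd : 0 < d)
    (hs : a + b = c + d) (h : validDomain a b c d x) :
    0 < cotRad (cotParam a b c d) (cotCoord x) := by
  have hpos := two_mul_bc_sub_pos ha hb hd hs h
  have hu : 0 < 1 + x := by linarith [h.1.1]
  have : cotRad (cotParam a b c d) (cotCoord x)
      = (2 * (b * c) - a * d * (1 + x)) / (a * d * (1 + x)) := by
    simp only [cotRad, cotParam, cotCoord_sq h.1]
    field_simp
    ring
  rw [this]
  positivity

lemma cotCoord_gfun {a b c d x : ℝ} (ha : 0 < a) (hb : 0 < b) (hc : 0 < c) (hd : 0 < d)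
    (hs : a + b = c + d) (h : validDomain a b c d x) :
    cotCoord (gfun a b c d x) = cotMap (cotParam a b c d) (cotCoord x) := by
  have hpos := two_mul_bc_sub_pos ha hb hd hs h
  have hg := one_add_gfun_mul ha hb hc hd hs h
  have hu : 0 < 1 + x := by linarith [h.1.1]
  have hv : 0 < 1 - x := by linarith [h.1.2]
  have hrad : cotRad (cotParam a b c d) (cotCoord x)
      = (2 * (b * c) - a * d * (1 + x)) / (a * d * (1 + x)) := by
    simp only [cotRad, cotParam, cotCoord_sq h.1]
    field_simp
    ring
  set S := √(a * d * (1 - x) * (2 * (b * c) - a * d * (1 + x)))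
  have hS : 0 ≤ S := Real.sqrt_nonneg _
  have hT : 0 < b * (a * c + b * d + a * d * (1 + x) + S) := by positivity
  have hG : 1 + gfun a b c d x
      = d * (1 + x) * (a + b) ^ 2 / (b * (a * c + b * d + a * d * (1 + x) + S)) := by
    rw [eq_div_iff hT.ne', hg]
  have hmap : 0 ≤ cotMap (cotParam a b c d) (cotCoord x) :=
    cotMap_nonneg (cotAdmissible_cotParam ha hb hc hd) (cotCoord_pos h.1).le
  have hprod : cotCoord x * √(cotRad (cotParam a b c d) (cotCoord x)) = S / (a * d * (1 + x)) := by
    have hS2 : S ^ 2 = a * d * (1 - x) * (2 * (b * c) - a * d * (1 + x)) :=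
      Real.sq_sqrt (by positivity)
    have hnonneg : 0 ≤ S / (a * d * (1 + x)) := by positivity
    rw [hrad, cotCoord, ← Real.sqrt_mul (div_pos hv hu).le, ← Real.sqrt_sq hnonneg, div_pow, hS2]
    congr 1
    field_simp
  have hR2 : √(cotRad (cotParam a b c d) (cotCoord x)) ^ 2
      = (2 * (b * c) - a * d * (1 + x)) / (a * d * (1 + x)) := by
    rw [hrad, Real.sq_sqrt (by positivity)]
  have hexpand : cotMap (cotParam a b c d) (cotCoord x) ^ 2
      = (b / (a + b)) ^ 2 * ((1 - x) / (1 + x))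
        + 2 * (b / (a + b)) * (1 - b / (a + b)) * (S / (a * d * (1 + x)))
        + (1 - b / (a + b)) ^ 2 * ((2 * (b * c) - a * d * (1 + x)) / (a * d * (1 + x))) := by
    rw [← hprod, ← hR2, ← cotCoord_sq h.1, cotMap]
    simp only [cotParam]
    ring
  have hsq : (1 - gfun a b c d x) / (1 + gfun a b c d x)
      = cotMap (cotParam a b c d) (cotCoord x) ^ 2 := by
    have h1 : 1 - gfun a b c d x = 2 - (1 + gfun a b c d x) := by ring
    rw [h1, hG, hexpand]
    clear_value S
    obtain rfl : c = a + b - d := by linarith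
    field_simp
    ring
  rw [cotCoord, hsq, Real.sqrt_sq hmap]

lemma gfun_parallelogram {a b x : ℝ} (ha : 0 < a) (hb : 0 < b) (h : validDomain a b a b x) :
    gfun a b a b x = x := by
  have hg := one_add_gfun_mul ha hb ha hb rfl h
  have hv : 0 < 1 - x := by linarith [h.1.2]
  have hS : √(a * b * (1 - x) * (2 * (b * a) - a * b * (1 + x))) = a * b * (1 - x) := by
    have h1 : a * b * (1 - x) * (2 * (b * a) - a * b * (1 + x)) = (a * b * (1 - x)) ^ 2 := by
      ring
    rw [h1, Real.sqrt_sq (by positivity)]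
  rw [hS] at hg
  have h1 : (gfun a b a b x - x) * (b * (a + b) ^ 2) = 0 := by linear_combination hg
  have h2 : b * (a + b) ^ 2 ≠ 0 := by positivity
  linarith [(mul_eq_zero.1 h1).resolve_right h2]

/-- Loop condition for a 3×3 planar quadrilateral kirigami tessellation: with four quadruples
`(aᵢ, bᵢ, cᵢ, dᵢ)` of positive reals satisfying `aᵢ + bᵢ = cᵢ + dᵢ` and `gᵢ = g(·; aᵢ, bᵢ, cᵢ, dᵢ)`,
if `I ⊆ (−1, 1)` is a nonempty open interval on which all the successive values
`x₄ = x, x₃ = g₄(x₄), x₂ = g₃(x₃), x₁ = g₂(x₂)` lie in the valid domains of the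
corresponding functions, then `g₁(g₂(g₃(g₄(x)))) = x` for all `x ∈ I` if and only if
`aᵢ = cᵢ` and `bᵢ = dᵢ` for every `i` (all four quadrilaterals are parallelograms). -/
theorem loop_condition_iff_parallelograms (a b c d : Fin 4 → ℝ)
    (ha : ∀ i, 0 < a i) (hb : ∀ i, 0 < b i) (hc : ∀ i, 0 < c i) (hd : ∀ i, 0 < d i)
    (hsum : ∀ i, a i + b i = c i + d i)
    (lo hi : ℝ) (hlohi : lo < hi) (I : Set ℝ) (hI : I = Ioo lo hi)
    (hsub : I ⊆ Ioo (-1 : ℝ) 1)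
    (hvalid : ∀ x ∈ I,
      validDomain (a 3) (b 3) (c 3) (d 3) x ∧
      validDomain (a 2) (b 2) (c 2) (d 2) (gfun (a 3) (b 3) (c 3) (d 3) x) ∧
      validDomain (a 1) (b 1) (c 1) (d 1)
        (gfun (a 2) (b 2) (c 2) (d 2) (gfun (a 3) (b 3) (c 3) (d 3) x)) ∧
      validDomain (a 0) (b 0) (c 0) (d 0)
        (gfun (a 1) (b 1) (c 1) (d 1)
          (gfun (a 2) (b 2) (c 2) (d 2) (gfun (a 3) (b 3) (c 3) (d 3) x)))) :
    (∀ x ∈ I, gfun (a 0) (b 0) (c 0) (d 0)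
        (gfun (a 1) (b 1) (c 1) (d 1)
          (gfun (a 2) (b 2) (c 2) (d 2) (gfun (a 3) (b 3) (c 3) (d 3) x))) = x)
    ↔ (∀ i, a i = c i ∧ b i = d i) := by
  subst hI
  constructor
  · intro hloop
    set L : List (ℝ × ℝ) := [cotParam (a 3) (b 3) (c 3) (d 3), cotParam (a 2) (b 2) (c 2) (d 2),
      cotParam (a 1) (b 1) (c 1) (d 1), cotParam (a 0) (b 0) (c 0) (d 0)] with hLdef
    have hL : ∀ p ∈ L, CotAdmissible p := by
      have := fun i => cotAdmissible_cotParam (ha i) (hb i) (hc i) (hd i)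
      simp [hLdef, this]
    have hreg : ∀ x ∈ Ioo lo hi, CotRegular L (cotCoord x) := fun x hx => by
      obtain ⟨h3, h2, h1, h0⟩ := hvalid x hx
      simp only [hLdef, CotRegular]
      rw [← cotCoord_gfun (ha 3) (hb 3) (hc 3) (hd 3) (hsum 3) h3,
        ← cotCoord_gfun (ha 2) (hb 2) (hc 2) (hd 2) (hsum 2) h2,
        ← cotCoord_gfun (ha 1) (hb 1) (hc 1) (hd 1) (hsum 1) h1]
      exact ⟨cotRad_cotParam_pos (ha 3) (hb 3) (hd 3) (hsum 3) h3,
        cotRad_cotParam_pos (ha 2) (hb 2) (hd 2) (hsum 2) h2,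
        cotRad_cotParam_pos (ha 1) (hb 1) (hd 1) (hsum 1) h1,
        cotRad_cotParam_pos (ha 0) (hb 0) (hd 0) (hsum 0) h0, trivial⟩
    have hid : ∀ x ∈ Ioo lo hi, cotComp L (cotCoord x) = cotCoord x := fun x hx => by
      obtain ⟨h3, h2, h1, h0⟩ := hvalid x hx
      simp only [hLdef, cotComp]
      rw [← cotCoord_gfun (ha 3) (hb 3) (hc 3) (hd 3) (hsum 3) h3,
        ← cotCoord_gfun (ha 2) (hb 2) (hc 2) (hd 2) (hsum 2) h2,
        ← cotCoord_gfun (ha 1) (hb 1) (hc 1) (hd 1) (hsum 1) h1,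
        ← cotCoord_gfun (ha 0) (hb 0) (hc 0) (hd 0) (hsum 0) h0, hloop x hx]
    obtain ⟨x₀, hx₀⟩ := nonempty_Ioo.2 hlohi
    have hX₀ := cotCoord_pos (hsub hx₀)
    have hcont : Continuous fun X : ℝ => (1 - X ^ 2) / (1 + X ^ 2) :=
      Continuous.div₀ (by fun_prop) (by fun_prop) fun X => by positivity
    have hnear : ∀ᶠ X in nhds (cotCoord x₀), cotComp L X = X := by
      have h1 : ∀ᶠ X in nhds (cotCoord x₀), (1 - X ^ 2) / (1 + X ^ 2) ∈ Ioo lo hi :=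
        hcont.continuousAt.eventually_mem
          (isOpen_Ioo.mem_nhds (by rw [inverse_cotCoord (hsub hx₀)]; exact hx₀))
      filter_upwards [h1, lt_mem_nhds hX₀] with X hX hXpos
      simpa only [cotCoord_inverse hXpos.le] using hid _ hX
    have hone := eq_one_of_cotComp_eq_id L hL
      (cotRegular_and_cotComp_eq L hL hX₀ (hreg x₀ hx₀) hnear)
    intro i
    refine cotParam_snd_eq_one (ha i) (hb i) (hd i) (hsum i) (hone _ ?_)
    fin_cases i <;> simp [hLdef]
  · intro hpar x hx
    obtain ⟨h3, h2, h1, h0⟩ := hvalid x hx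
    have hg : ∀ i y, validDomain (a i) (b i) (c i) (d i) y →
        gfun (a i) (b i) (c i) (d i) y = y := fun i y hy => by
      rw [← (hpar i).1, ← (hpar i).2] at hy ⊢
      exact gfun_parallelogram (ha i) (hb i) hy
    rw [hg 0 _ h0, hg 1 _ h1, hg 2 _ h2, hg 3 _ h3]
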